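/- Let n ≥ 1 be an integer, let p, q ∈ ℂ with 0 < |p| < 1 and 0 < |q| < 1, and let x_1, ..., x_n, y_1, ..., y_n ∈ ℂ satisfy max(|p|,|q|) < |x_i| < 1 and max(|p|,|q|) < |y_i| < 1 for all i, together with θ(x_i/x_j;p) ≠ 0 and θ(y_i/y_j;q) ≠ 0 for all i ≠ j. Set X = ∏_{i=1}^{n} x_i and Y = ∏_{i=1}^{n} y_i. Then for every holomorphic function f : ℂ∖{0} → ℂ: (1/(2π)^n) ∫_{[0,2π]^n} f(X·Z) · ∏_{1≤i<j≤n} θ(z_i/z_j;p) θ(z_j/z_i;q) / ∏_{1≤i,j≤n} θ(x_i z_j;p) θ(y_i/z_j;q) dθ₁⋯dθₙ = ∏_{1≤i<j≤n} ( θ(x_i/x_j;q) θ(y_i/y_j;p) / ( θ(x_i/x_j;p) θ(y_i/y_j;q) ) ) · (1/(2π)^n) ∫_{[0,2π]^n} f(Y·Z) · ∏_{1≤i<j≤n} θ(z_i/z_j;p) θ(z_j/z_i;q) / ∏_{1≤i,j≤n} θ(y_i z_j;p) θ(x_i/z_j;q) dθ₁⋯dθₙ, where z_j = e^{iθ_j}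 and Z = z_1⋯z_n. -/

import Mathlib

open scoped BigOperators Real
open MeasureTheory

/-- The theta function `θ(x;p)`. -/
noncomputable def ellTheta (x p : ℂ) : ℂ :=
  ∏' k : ℕ, ((1 - p ^ k * x) * (1 - p ^ (k + 1) / x))

/-- `n`-fold contour integral over the unit torus. -/
noncomputable def torusInt (n : ℕ) (f : (Fin n → ℂ) → ℂ) : ℂ :=
  ((1 / (2 * Real.pi) : ℝ) : ℂ) ^ n *
    ∫ θ in Set.univ.pi fun _ : Fin n => Set.Icc (0 : ℝ) (2 * Real.pi),
      f fun i => Complex.exp (Complex.I * (θ i))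

/-- The infinite `q`-Pochhammer symbol `(x;p)_∞`. -/
noncomputable def qPoch (x p : ℂ) : ℂ := ∏' k : ℕ, (1 - p ^ k * x)

lemma summable_norm_neg_pow_mul {p : ℂ} (hp : ‖p‖ < 1) (x : ℂ) :
    Summable fun k : ℕ => ‖-(p ^ k * x)‖ := by
  simpa using (summable_geometric_of_lt_one (norm_nonneg p) hp).mul_right ‖x‖

lemma multipliable_qPoch {p : ℂ} (hp : ‖p‖ < 1) (x : ℂ) :
    Multipliable fun k : ℕ => 1 - p ^ k * x := by
  simpa [sub_eq_add_neg] using multipliable_one_add_of_summable (summable_norm_neg_pow_mul hp x)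

lemma qPoch_eq_mul {p : ℂ} (hp : ‖p‖ < 1) (x : ℂ) :
    qPoch x p = (1 - x) * qPoch (p * x) p := by
  have h : ∀ k : ℕ, 1 - p ^ (k + 1) * x = 1 - p ^ k * (p * x) := fun k => by ring
  unfold qPoch
  rw [tprod_eq_zero_mul' (by simpa only [h] using multipliable_qPoch hp (p * x))]
  simp only [h]
  simp

lemma ellTheta_eq {p : ℂ} (hp : ‖p‖ < 1) (x : ℂ) :
    ellTheta x p = qPoch x p * qPoch (p / x) p := by
  unfold ellTheta qPoch
  rw [← (multipliable_qPoch hp x).tprod_mul (multipliable_qPoch hp (p / x))]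
  congr! 3 with k
  ring

lemma qPoch_ne_zero {p : ℂ} (hp : ‖p‖ < 1) {x : ℂ} (h : ∀ k : ℕ, p ^ k * x ≠ 1) :
    qPoch x p ≠ 0 := by
  have := tprod_one_add_ne_zero_of_summable (f := fun k : ℕ => -(p ^ k * x))
    (fun k hk => h k (by linear_combination -hk)) (summable_norm_neg_pow_mul hp x)
  simpa [qPoch, sub_eq_add_neg] using this

lemma differentiable_qPoch {p : ℂ} (hp : ‖p‖ < 1) : Differentiable ℂ fun x => qPoch x p := by
  have key : ∀ R : ℝ, DifferentiableOn ℂ (fun x => qPoch x p) (Metric.ball 0 R) := by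
    intro R
    have h : HasProdLocallyUniformlyOn (fun (k : ℕ) (x : ℂ) => 1 + -(p ^ k * x))
        (fun x => ∏' k : ℕ, (1 + -(p ^ k * x))) (Metric.ball 0 R) := by
      refine Summable.hasProdLocallyUniformlyOn_nat_one_add Metric.isOpen_ball
        ((summable_geometric_of_lt_one (norm_nonneg p) hp).mul_right R)
        (.of_forall fun k x hx => ?_) (fun k => by fun_prop)
      rw [norm_neg, norm_mul, norm_pow]
      have : ‖x‖ < R := by simpa using hx
      gcongr
    have h' := h.differentiableOn (.of_forall fun s => by
      simpa [Finset.prod_fn] using DifferentiableOn.finsetProd (fun _ _ => by fun_prop))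
        Metric.isOpen_ball
    simpa [qPoch, sub_eq_add_neg] using h'
  intro x
  exact (key (‖x‖ + 1)).differentiableAt (Metric.isOpen_ball.mem_nhds (by simp))

lemma differentiableAt_ellTheta {p : ℂ} (hp : ‖p‖ < 1) {x : ℂ} (hx : x ≠ 0) :
    DifferentiableAt ℂ (fun x => ellTheta x p) x := by
  simp only [ellTheta_eq hp]
  have h := differentiable_qPoch hp
  exact (h x).mul ((h (p / x)).comp x (by fun_prop (disch := assumption)))

lemma continuousAt_ellTheta {p : ℂ} (hp : ‖p‖ < 1) {x : ℂ} (hx : x ≠ 0) :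
    ContinuousAt (fun x => ellTheta x p) x := (differentiableAt_ellTheta hp hx).continuousAt

lemma ellTheta_inv {p : ℂ} (hp : ‖p‖ < 1) {x : ℂ} (hx : x ≠ 0) :
    ellTheta x⁻¹ p = -x⁻¹ * ellTheta x p := by
  rw [ellTheta_eq hp, ellTheta_eq hp, qPoch_eq_mul hp x⁻¹, qPoch_eq_mul hp x, div_inv_eq_mul,
    ← div_eq_mul_inv]
  field_simp
  ring

lemma ellTheta_mul_left {p : ℂ} (hp : ‖p‖ < 1) (hp0 : p ≠ 0) {x : ℂ} (hx : x ≠ 0) :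
    ellTheta (p * x) p = -x⁻¹ * ellTheta x p := by
  rw [← ellTheta_inv hp hx, ellTheta_eq hp, ellTheta_eq hp, div_inv_eq_mul,
    div_mul_cancel_left₀ hp0, mul_comm]

/-- The theta function vanishes only at integral powers of the nome. -/
lemma ellTheta_ne_zero {p : ℂ} (hp : ‖p‖ < 1) (hp0 : p ≠ 0) {x : ℂ} (hx : x ≠ 0)
    (h : ∀ m : ℤ, ‖x‖ ≠ ‖p‖ ^ m) : ellTheta x p ≠ 0 := by
  rw [ellTheta_eq hp]
  have hpn : ‖p‖ ≠ 0 := norm_ne_zero_iff.mpr hp0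
  refine mul_ne_zero (qPoch_ne_zero hp fun k hk => h (-k) ?_)
    (qPoch_ne_zero hp fun k hk => h (k + 1) ?_)
  · have := congrArg norm hk
    rw [norm_mul, norm_pow, norm_one] at this
    rw [zpow_neg, zpow_natCast]
    exact eq_inv_of_mul_eq_one_right this
  · have := congrArg norm hk
    rw [norm_mul, norm_pow, norm_one, norm_div] at this
    have hxn : ‖x‖ ≠ 0 := norm_ne_zero_iff.mpr hx
    field_simp at this
    rw [zpow_add_one₀ hpn, zpow_natCast, this]

lemma ellTheta_ne_zero_of_norm_lt {p : ℂ} (hp : ‖p‖ < 1) (hp0 : p ≠ 0) {x : ℂ}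
    (h1 : ‖p‖ < ‖x‖) (h2 : ‖x‖ < 1) : ellTheta x p ≠ 0 := by
  have hpn : 0 < ‖p‖ := norm_pos_iff.mpr hp0
  refine ellTheta_ne_zero hp hp0 (norm_pos_iff.mp (hpn.trans h1)) fun m hm => ?_
  rw [hm] at h1 h2
  have hm0 : 0 < m := by
    by_contra! hc
    exact absurd h2 (not_lt.mpr (one_le_zpow_of_nonpos₀ hpn hp.le hc))
  have : m < 1 := (zpow_lt_zpow_iff_right_of_lt_one₀ hpn hp).mp (by simpa using h1)
  omega

/-- Circle averages over concentric circles agree for a function holomorphic in between. -/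
lemma circleAverage_eq_of_differentiableAt_annulus {h : ℂ → ℂ} {r R : ℝ} (hr : 0 < r) (hR : 0 < R)
    (hd : ∀ z, min r R ≤ ‖z‖ → ‖z‖ ≤ max r R → DifferentiableAt ℂ h z) :
    Real.circleAverage h 0 r = Real.circleAverage h 0 R := by
  wlog hle : r ≤ R generalizing r R
  · exact (this hR hr (by simpa [min_comm, max_comm] using hd) (le_of_not_ge hle)).symm
  rw [min_eq_left hle, max_eq_right hle] at hd
  rw [Real.circleAverage_eq_circleIntegral hr.ne', Real.circleAverage_eq_circleIntegral hR.ne',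
    Complex.circleIntegral_sub_center_inv_smul_eq_of_differentiable_on_annulus_off_countable hr hle
      Set.countable_empty]
  · intro z hz
    simp only [Set.mem_sdiff, mem_closedBall_zero_iff, mem_ball_zero_iff, not_lt] at hz
    exact (hd z hz.2 hz.1).continuousAt.continuousWithinAt
  · intro z hz
    simp only [Set.mem_sdiff, mem_closedBall_zero_iff, mem_ball_zero_iff, not_le] at hz
    exact hd z hz.1.2.le hz.1.1.le

/-- Laurent coefficients at the origin of a function holomorphic on the punctured plane. -/
noncomputable def laurentCoeff (f : ℂ → ℂ) (k : ℤ) : ℂ :=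
  Real.circleAverage (fun z => f z * z ^ (-k)) 0 1

section Laurent

variable {f : ℂ → ℂ} (hf : ∀ z, z ≠ 0 → DifferentiableAt ℂ f z)

include hf

lemma circleAverage_mul_zpow {r : ℝ} (hr : 0 < r) (k : ℤ) :
    Real.circleAverage (fun z => f z * z ^ (-k)) 0 r = laurentCoeff f k := by
  refine circleAverage_eq_of_differentiableAt_annulus hr one_pos fun z hz _ => ?_
  have h0 : z ≠ 0 := norm_pos_iff.mp ((lt_min hr one_pos).trans_le hz)
  exact (hf z h0).mul ((differentiableAt_zpow (m := -k)).mpr (Or.inl h0))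

lemma continuous_comp_circleMap {r : ℝ} (hr : 0 < r) :
    Continuous fun t => f (circleMap 0 r t) :=
  continuous_iff_continuousAt.mpr fun t =>
    ContinuousAt.comp (g := f) (hf _ (circleMap_ne_center hr.ne')).continuousAt
      (by fun_prop)

lemma exists_norm_laurentCoeff_le {r : ℝ} (hr : 0 < r) :
    ∃ M : ℝ, 0 ≤ M ∧ ∀ k : ℤ, ‖laurentCoeff f k‖ ≤ M * r ^ (-k) := by
  obtain ⟨M, hM⟩ := (isCompact_Icc (a := (0 : ℝ)) (b := 2 * π)).exists_bound_of_continuousOn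
    (continuous_comp_circleMap hf hr).continuousOn
  have hM0 : 0 ≤ M := (norm_nonneg _).trans (hM 0 ⟨le_rfl, by positivity⟩)
  refine ⟨M, hM0, fun k => ?_⟩
  rw [← circleAverage_mul_zpow hf hr k, Real.circleAverage_def, norm_smul]
  have h := intervalIntegral.norm_integral_le_of_norm_le_const (a := (0 : ℝ)) (b := 2 * π)
    (C := M * r ^ (-k)) (f := fun t => f (circleMap 0 r t) * circleMap 0 r t ^ (-k)) (by
      intro t ht
      rw [Set.uIoc_of_le (by positivity)] at ht
      rw [norm_mul, norm_zpow, norm_circleMap_zero, abs_of_pos hr]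
      gcongr
      exact hM t ⟨ht.1.le, ht.2⟩)
  rw [sub_zero, abs_of_pos (by positivity : 0 < 2 * π)] at h
  rw [norm_inv, Real.norm_of_nonneg (by positivity : 0 ≤ 2 * π),
    inv_mul_le_iff₀ (by positivity)]
  linarith

lemma summable_norm_laurentCoeff_mul {r : ℝ} (hr : 0 < r) :
    Summable fun k : ℤ => ‖laurentCoeff f k‖ * r ^ k := by
  have geo := summable_geometric_two
  refine Summable.of_nat_of_neg ?_ ?_
  · obtain ⟨M, hM0, hM⟩ := exists_norm_laurentCoeff_le hf (mul_pos two_pos hr)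
    refine Summable.of_nonneg_of_le (fun k => by positivity) (fun k => ?_) (geo.mul_left M)
    calc _ ≤ M * (2 * r) ^ (-(k : ℤ)) * r ^ (k : ℤ) := by gcongr; exact hM k
      _ = M * (1 / 2) ^ k := by
        rw [zpow_neg, zpow_natCast, zpow_natCast, mul_pow, one_div, inv_pow]
        field_simp
  · obtain ⟨M, hM0, hM⟩ := exists_norm_laurentCoeff_le hf (half_pos hr)
    refine Summable.of_nonneg_of_le (fun k => by positivity) (fun k => ?_) (geo.mul_left M)
    calc _ ≤ M * (r / 2) ^ (-(-(k : ℤ))) * r ^ (-(k : ℤ)) := by gcongr; exact hM (-k)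
      _ = M * (1 / 2) ^ k := by
        rw [neg_neg, zpow_neg, zpow_natCast, zpow_natCast, div_pow, one_div, inv_pow]
        field_simp

lemma hasSum_laurentCoeff {w : ℂ} (hw : w ≠ 0) :
    HasSum (fun k : ℤ => laurentCoeff f k * w ^ k) (f w) := by
  have : Fact (0 < 2 * π) := ⟨by positivity⟩
  have hr : 0 < ‖w‖ := norm_pos_iff.mpr hw
  set r := ‖w‖
  have hr' : (r : ℂ) ≠ 0 := by exact_mod_cast hr.ne'
  have hfour : ∀ (k : ℤ) (t : ℝ), fourier k (t : AddCircle (2 * π)) =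
      Complex.exp (t * Complex.I) ^ k := by
    intro k t
    rw [fourier_coe_apply, ← Complex.exp_int_mul]
    congr 1
    push_cast
    field_simp
  have hcm : ∀ t : ℝ, circleMap 0 r t = r * Complex.exp (t * Complex.I) := by
    intro t; simp [circleMap]
  let g : C(AddCircle (2 * π), ℂ) := ⟨fun t => f (r * fourier 1 t), by
    refine continuous_iff_continuousAt.mpr fun t => ContinuousAt.comp (g := f) ?_ (by fun_prop)
    refine (hf _ (mul_ne_zero hr' ?_)).continuousAt
    rw [fourier_apply]
    exact Circle.coe_ne_zero _⟩
  have hg : ∀ t : ℝ, g t = f (circleMap 0 r t) := by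
    intro t
    change f (r * fourier 1 (t : AddCircle (2 * π))) = _
    rw [hfour, hcm, zpow_one]
  have hcoef : ∀ k : ℤ, fourierCoeff g k = laurentCoeff f k * (r : ℂ) ^ k := by
    intro k
    rw [fourierCoeff_eq_intervalIntegral _ _ 0, ← circleAverage_mul_zpow hf hr k,
      Real.circleAverage_def, zero_add, one_div, smul_mul_assoc,
      ← intervalIntegral.integral_mul_const]
    congr 1
    refine intervalIntegral.integral_congr fun t _ => ?_
    simp only [hg, hfour, hcm, smul_eq_mul, mul_zpow, zpow_neg]
    field_simp
  have hsum : Summable (fourierCoeff g) := by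
    refine Summable.of_norm ?_
    simpa [hcoef, abs_of_pos hr] using summable_norm_laurentCoeff_mul hf hr
  have key := has_pointwise_sum_fourier_series_of_summable hsum (w.arg : AddCircle (2 * π))
  have hwe : circleMap 0 r w.arg = w := by rw [hcm]; exact Complex.norm_mul_exp_arg_mul_I w
  rw [hg, hwe] at key
  convert key using 2 with k
  rw [hcoef, hfour, smul_eq_mul, mul_assoc, ← mul_zpow, ← hcm, hwe]

end Laurent

lemma circleAverage_comp_const_mul (h : ℂ → ℂ) (c : ℂ) (r : ℝ) :
    Real.circleAverage (fun z => h (c * z)) 0 r = Real.circleAverage h 0 (‖c‖ * r) := by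
  rw [Real.circleAverage_eq_integral_add c.arg (f := h), Real.circleAverage_def]
  congr 1
  refine intervalIntegral.integral_congr fun t _ => ?_
  simp only [circleMap_zero]
  congr 1
  conv_lhs => rw [← Complex.norm_mul_exp_arg_mul_I c]
  push_cast
  rw [add_mul, Complex.exp_add]
  ring

lemma laurentCoeff_quasiperiodic {p : ℂ} (hp0 : p ≠ 0) {f : ℂ → ℂ}
    (hf : ∀ z, z ≠ 0 → DifferentiableAt ℂ f z) {c : ℂ} {d : ℤ}
    (h : ∀ z, z ≠ 0 → f (p * z) = c * z ^ (-d) * f z) (k : ℤ) :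
    laurentCoeff f k = c * p ^ (-k) * laurentCoeff f (k + d) := by
  have h1 := circleAverage_comp_const_mul (fun z => f z * z ^ (-k)) p 1
  rw [mul_one, circleAverage_mul_zpow hf (norm_pos_iff.mpr hp0) k] at h1
  rw [← h1, laurentCoeff, ← smul_eq_mul, ← Real.circleAverage_fun_smul]
  refine Real.circleAverage_congr_sphere fun z hz => ?_
  have hz : z ≠ 0 := by rintro rfl; simp at hz
  simp only [h z hz, smul_eq_mul]
  rw [mul_zpow, show -(k + d) = -k + -d by ring, zpow_add₀ hz]
  ring

/-- Theta functions of degree two span a space of dimension at most two. -/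
lemma exists_degree_two_expansion {p : ℂ} (hp0 : p ≠ 0) :
    ∃ U V : ℂ → ℂ, ∀ f : ℂ → ℂ, (∀ z, z ≠ 0 → DifferentiableAt ℂ f z) →
      (∀ z, z ≠ 0 → f (p * z) = z ^ (-2 : ℤ) * f z) →
      ∀ w, w ≠ 0 → f w = laurentCoeff f 0 * U w + laurentCoeff f 1 * V w := by
  classical
  let S : Set ℤ := {k | Even k}
  refine ⟨fun w => ∑' k : ℤ, S.indicator (fun k => p ^ (k / 2 * (k / 2 - 1)) * w ^ k) k,
    fun w => ∑' k : ℤ, Sᶜ.indicator (fun k => p ^ (k / 2 * (k / 2)) * w ^ k) k,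
    fun f hf h w hw => ?_⟩
  have hrec : ∀ k : ℤ, laurentCoeff f (k + 2) = p ^ k * laurentCoeff f k := by
    intro k
    rw [laurentCoeff_quasiperiodic hp0 hf (c := 1) (d := 2) (by simpa using h) k, one_mul,
      ← mul_assoc, ← zpow_add₀ hp0, add_neg_cancel, zpow_zero, one_mul]
  have heven : ∀ j : ℤ, laurentCoeff f (2 * j) = laurentCoeff f 0 * p ^ (j * (j - 1)) := by
    intro j
    induction j using Int.induction_on with
    | zero => simp
    | succ i ih =>
      rw [show 2 * ((i : ℤ) + 1) = 2 * i + 2 by ring, hrec, ih,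
        show ((i : ℤ) + 1) * (i + 1 - 1) = 2 * i + i * (i - 1) by ring, zpow_add₀ hp0]
      ring
    | pred i ih =>
      have h2 := hrec (2 * (-(i : ℤ) - 1))
      rw [show 2 * (-(i : ℤ) - 1) + 2 = 2 * -i by ring, ih,
        show -(i : ℤ) * (-i - 1) = 2 * (-(i : ℤ) - 1) + (-(i : ℤ) - 1) * (-i - 1 - 1) by ring,
        zpow_add₀ hp0] at h2
      have := zpow_ne_zero (2 * (-(i : ℤ) - 1)) hp0
      apply mul_left_cancel₀ this
      rw [← h2]
      ring
  have hodd : ∀ j : ℤ, laurentCoeff f (2 * j + 1) = laurentCoeff f 1 * p ^ (j * j) := by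
    intro j
    induction j using Int.induction_on with
    | zero => simp
    | succ i ih =>
      rw [show 2 * ((i : ℤ) + 1) + 1 = 2 * i + 1 + 2 by ring, hrec, ih,
        show ((i : ℤ) + 1) * (i + 1) = 2 * i + 1 + i * i by ring, zpow_add₀ hp0 _ (i * i : ℤ)]
      ring
    | pred i ih =>
      have h2 := hrec (2 * (-(i : ℤ) - 1) + 1)
      rw [show 2 * (-(i : ℤ) - 1) + 1 + 2 = 2 * -i + 1 by ring, ih,
        show -(i : ℤ) * (-i) = (2 * (-(i : ℤ) - 1) + 1) + (-(i : ℤ) - 1) * (-i - 1) by ring,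
        zpow_add₀ hp0 _ ((-(i : ℤ) - 1) * (-i - 1))] at h2
      have := zpow_ne_zero (2 * (-(i : ℤ) - 1) + 1) hp0
      apply mul_left_cancel₀ this
      rw [← h2]
      ring
  have hsum := hasSum_laurentCoeff hf hw
  rw [← tsum_mul_left, ← tsum_mul_left, ← hsum.tsum_eq]
  have hE : ∀ k : ℤ, laurentCoeff f 0 *
      S.indicator (fun k => p ^ (k / 2 * (k / 2 - 1)) * w ^ k) k =
      S.indicator (fun k => laurentCoeff f k * w ^ k) k := by
    intro k
    by_cases hk : k ∈ S
    · rw [Set.indicator_of_mem hk, Set.indicator_of_mem hk, ← mul_assoc]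
      obtain ⟨j, rfl⟩ := even_iff_exists_two_mul.mp hk
      rw [heven, Int.mul_ediv_cancel_left j two_ne_zero]
    · simp [Set.indicator_of_notMem hk]
  have hO : ∀ k : ℤ, laurentCoeff f 1 * Sᶜ.indicator (fun k => p ^ (k / 2 * (k / 2)) * w ^ k) k =
      Sᶜ.indicator (fun k => laurentCoeff f k * w ^ k) k := by
    intro k
    by_cases hk : k ∈ Sᶜ
    · rw [Set.indicator_of_mem hk, Set.indicator_of_mem hk, ← mul_assoc]
      obtain ⟨j, rfl⟩ := Int.not_even_iff_odd.mp hk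
      rw [hodd, show (2 * j + 1) / 2 = j by omega]
    · simp [Set.indicator_of_notMem hk]
  simp only [hE, hO]
  rw [← (hsum.summable.indicator S).tsum_add (hsum.summable.indicator Sᶜ)]
  refine tsum_congr fun k => ?_
  exact (congrFun (Set.indicator_self_add_compl S fun k => laurentCoeff f k * w ^ k) k).symm

section Addition

variable {p : ℂ} (hp : ‖p‖ < 1) (hp0 : p ≠ 0)

include hp hp0

lemma ellTheta_pair_expansion : ∃ A B U V : ℂ → ℂ, ∀ x y : ℂ, x ≠ 0 → y ≠ 0 →
    y * (ellTheta (x * y) p * ellTheta (x / y) p) = A y * U x + B y * V x := by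
  obtain ⟨U, V, h⟩ := exists_degree_two_expansion hp0
  refine ⟨fun y => y * laurentCoeff (fun x => ellTheta (x * y) p * ellTheta (x / y) p) 0,
    fun y => y * laurentCoeff (fun x => ellTheta (x * y) p * ellTheta (x / y) p) 1, U, V,
    fun x y hx hy => ?_⟩
  have := h (fun x => ellTheta (x * y) p * ellTheta (x / y) p) ?_ ?_ x hx
  · rw [this]
    ring
  · intro z hz
    exact ((differentiableAt_ellTheta hp (mul_ne_zero hz hy)).comp (f := fun x => x * y) z
      (by fun_prop)).mul ((differentiableAt_ellTheta hp (div_ne_zero hz hy)).comp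
      (f := fun x => x / y) z (by fun_prop))
  · intro z hz
    simp only [mul_assoc, mul_div_assoc]
    rw [ellTheta_mul_left hp hp0 (mul_ne_zero hz hy), ellTheta_mul_left hp hp0 (div_ne_zero hz hy),
      zpow_neg]
    field_simp

/-- The Weierstrass addition formula. -/
lemma ellTheta_addition {x y u v : ℂ} (hx : x ≠ 0) (hy : y ≠ 0) (hu : u ≠ 0) (hv : v ≠ 0) :
    ellTheta (x * y) p * ellTheta (x / y) p * (ellTheta (u * v) p * ellTheta (u / v) p) -
      ellTheta (x * v) p * ellTheta (x / v) p * (ellTheta (u * y) p * ellTheta (u / y) p) =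
    u / y * (ellTheta (x * u) p * ellTheta (x / u) p *
      (ellTheta (y * v) p * ellTheta (y / v) p)) := by
  obtain ⟨A, B, U, V, h⟩ := ellTheta_pair_expansion hp hp0
  set F : ℂ → ℂ → ℂ := fun x y => y * (ellTheta (x * y) p * ellTheta (x / y) p) with hF
  have hanti : ∀ x y, x ≠ 0 → y ≠ 0 → F y x = -F x y := by
    intro x y hx hy
    have := ellTheta_inv hp (div_ne_zero hx hy)
    simp only [hF]
    rw [inv_div] at this
    rw [this, mul_comm y x]
    field_simp
  have hdiag : ∀ x, x ≠ 0 → F x x = 0 := fun x hx => by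
    have := hanti x x hx hx
    linear_combination this / 2
  have hFe : ∀ x y, x ≠ 0 → y ≠ 0 → F x y = A y * U x + B y * V x := h
  have minor : ∀ r₁ r₂ r₃ c₁ c₂ c₃ : ℂ, r₁ ≠ 0 → r₂ ≠ 0 → r₃ ≠ 0 → c₁ ≠ 0 → c₂ ≠ 0 → c₃ ≠ 0 →
      F r₁ c₁ * (F r₂ c₂ * F r₃ c₃ - F r₂ c₃ * F r₃ c₂) -
      F r₁ c₂ * (F r₂ c₁ * F r₃ c₃ - F r₂ c₃ * F r₃ c₁) +
      F r₁ c₃ * (F r₂ c₁ * F r₃ c₂ - F r₂ c₂ * F r₃ c₁) = 0 := by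
    intro r₁ r₂ r₃ c₁ c₂ c₃ h₁ h₂ h₃ h₄ h₅ h₆
    simp only [hFe _ _ h₁ h₄, hFe _ _ h₁ h₅, hFe _ _ h₁ h₆, hFe _ _ h₂ h₄, hFe _ _ h₂ h₅,
      hFe _ _ h₂ h₆, hFe _ _ h₃ h₄, hFe _ _ h₃ h₅, hFe _ _ h₃ h₆]
    ring
  have pf : F x y * F u v - F x u * F y v + F x v * F y u = 0 := by
    by_contra hne
    have m1 := minor x y u x y v hx hy hu hx hy hv
    have m2 := minor x y u x u v hx hy hu hx hu hv
    have m3 := minor x y v x u v hx hy hv hx hu hv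
    simp only [hdiag _ hx, hdiag _ hy, hdiag _ hu, hdiag _ hv, hanti _ _ hx hy, hanti _ _ hx hu,
      hanti _ _ hx hv, hanti _ _ hy hu, hanti _ _ hu hv] at m1 m2 m3
    have n1 : F x y = 0 := (mul_eq_zero.mp (by linear_combination m1 :
      F x y * (F x y * F u v - F x u * F y v + F x v * F y u) = 0)).resolve_right hne
    have n2 : F x u = 0 := (mul_eq_zero.mp (by linear_combination m2 :
      F x u * (F x y * F u v - F x u * F y v + F x v * F y u) = 0)).resolve_right hne
    have n3 : F x v = 0 := (mul_eq_zero.mp (by linear_combination m3 :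
      F x v * (F x y * F u v - F x u * F y v + F x v * F y u) = 0)).resolve_right hne
    exact hne (by rw [n1, n2, n3]; ring)
  rw [show F y u = -F u y by exact hanti u y hu hy] at pf
  simp only [hF] at pf
  apply mul_left_cancel₀ (mul_ne_zero hy hv)
  linear_combination pf - v * (ellTheta (x * u) p * ellTheta (x / u) p *
      (ellTheta (y * v) p * ellTheta (y / v) p)) * mul_div_cancel₀ u hy

lemma laurentCoeff_ellTheta_zero_ne_zero : laurentCoeff (fun x => ellTheta x p) 0 ≠ 0 := by
  intro h0
  have hd : ∀ z, z ≠ 0 → DifferentiableAt ℂ (fun x => ellTheta x p) z :=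
    fun z hz => differentiableAt_ellTheta hp hz
  have hrec := laurentCoeff_quasiperiodic hp0 hd (c := -1) (d := 1) (fun z hz => by
    rw [ellTheta_mul_left hp hp0 hz]; simp)
  have hall : ∀ k : ℤ, laurentCoeff (fun x => ellTheta x p) k = 0 := by
    intro k
    induction k using Int.induction_on with
    | zero => exact h0
    | succ i ih =>
      rw [hrec] at ih
      exact (mul_eq_zero.mp ih).resolve_left (mul_ne_zero (by norm_num) (zpow_ne_zero _ hp0))
    | pred i ih => rw [hrec, sub_add_cancel, ih, mul_zero]
  obtain ⟨r, hr1, hr2⟩ := exists_between hp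
  have hr0 : 0 < r := (norm_nonneg p).trans_lt hr1
  have hrn : ‖(r : ℂ)‖ = r := by simp [abs_of_pos hr0]
  have hs := hasSum_laurentCoeff hd (w := (r : ℂ)) (by exact_mod_cast hr0.ne')
  simp only [hall, zero_mul] at hs
  exact ellTheta_ne_zero_of_norm_lt hp hp0 (by rwa [hrn]) (by rwa [hrn])
    (hs.unique hasSum_zero)

/-- The form of the addition formula used for Gaussian elimination. -/
lemma ellTheta_two_by_two {t x₀ x z₀ z : ℂ} (ht : t ≠ 0) (hx₀ : x₀ ≠ 0) (hx : x ≠ 0)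
    (hz₀ : z₀ ≠ 0) (hz : z ≠ 0) :
    ellTheta (t * (x₀ * z₀)) p * ellTheta (t * (x * z)) p *
        (ellTheta (x * z₀) p * ellTheta (x₀ * z) p) -
      ellTheta (t * (x * z₀)) p * ellTheta (t * (x₀ * z)) p *
        (ellTheta (x₀ * z₀) p * ellTheta (x * z) p) =
    x * z * (ellTheta (t * (x₀ * z₀) * (x * z)) p * ellTheta t p *
      (ellTheta (x₀ / x) p * ellTheta (z₀ / z) p)) := by
  obtain ⟨a, rfl⟩ := IsAlgClosed.exists_pow_nat_eq x₀ two_pos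
  obtain ⟨b, rfl⟩ := IsAlgClosed.exists_pow_nat_eq x two_pos
  obtain ⟨c, rfl⟩ := IsAlgClosed.exists_pow_nat_eq z₀ two_pos
  obtain ⟨d, rfl⟩ := IsAlgClosed.exists_pow_nat_eq z two_pos
  rw [pow_ne_zero_iff two_ne_zero] at hx₀ hx hz₀ hz
  have h := ellTheta_addition hp hp0 (x := t * a * b * c * d) (y := a * c / (b * d))
    (u := a * b * c * d) (v := b * c / (a * d)) (by positivity) (by positivity) (by positivity)
    (by positivity)
  have e1 : t * a * b * c * d * (a * c / (b * d)) = t * (a ^ 2 * c ^ 2) := by field_simp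
  have e2 : t * a * b * c * d / (a * c / (b * d)) = t * (b ^ 2 * d ^ 2) := by field_simp
  have e3 : a * b * c * d * (b * c / (a * d)) = b ^ 2 * c ^ 2 := by field_simp
  have e4 : a * b * c * d / (b * c / (a * d)) = a ^ 2 * d ^ 2 := by field_simp
  have e5 : t * a * b * c * d * (b * c / (a * d)) = t * (b ^ 2 * c ^ 2) := by field_simp
  have e6 : t * a * b * c * d / (b * c / (a * d)) = t * (a ^ 2 * d ^ 2) := by field_simp
  have e7 : a * b * c * d * (a * c / (b * d)) = a ^ 2 * c ^ 2 := by field_simp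
  have e8 : a * b * c * d / (a * c / (b * d)) = b ^ 2 * d ^ 2 := by field_simp
  have e9 : t * a * b * c * d * (a * b * c * d) = t * (a ^ 2 * c ^ 2) * (b ^ 2 * d ^ 2) := by ring
  have e10 : t * a * b * c * d / (a * b * c * d) = t := by field_simp
  have e11 : a * c / (b * d) * (b * c / (a * d)) = c ^ 2 / d ^ 2 := by field_simp
  have e12 : a * c / (b * d) / (b * c / (a * d)) = a ^ 2 / b ^ 2 := by field_simp
  rw [e1, e2, e3, e4, e5, e6, e7, e8, e9, e10, e11, e12] at h
  rw [h]
  ring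

end Addition

lemma Matrix.det_succ_eq_mul_det_schur {K : Type*} [Field K] {n : ℕ}
    (M : Matrix (Fin (n + 1)) (Fin (n + 1)) K) (h : M 0 0 ≠ 0) :
    M.det = M 0 0 * (Matrix.of fun i j : Fin n =>
      M i.succ j.succ - M i.succ 0 * M 0 j.succ / M 0 0).det := by
  let c : Fin (n + 1) → K := Fin.cons 0 fun i => M i.succ 0 / M 0 0
  let B : Matrix (Fin (n + 1)) (Fin (n + 1)) K := Matrix.of fun i j => M i j - c i * M 0 j
  have hB : M.det = B.det :=
    Matrix.det_eq_of_forall_row_eq_smul_add_const c 0 rfl fun i j => by simp [B, c]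
  rw [hB, Matrix.det_succ_column_zero, Fin.sum_univ_succ, Finset.sum_eq_zero, add_zero]
  · have h0 : B 0 0 = M 0 0 := by simp [B, c]
    rw [h0]
    simp only [Fin.val_zero, pow_zero, one_mul, Fin.succAbove_zero]
    congr 2
    ext i j
    simp only [Matrix.submatrix_apply, Matrix.of_apply, B, c, Fin.cons_succ]
    ring
  · intro i _
    have : B i.succ 0 = 0 := by simp [B, c, h]
    rw [this]
    ring

/-- The Frobenius determinant formula for theta functions. -/
lemma ellTheta_frobenius {p : ℂ} (hp : ‖p‖ < 1) (hp0 : p ≠ 0) (n : ℕ) (x z : Fin n → ℂ)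
    (hx : ∀ i, x i ≠ 0) (hz : ∀ i, z i ≠ 0) (hxz : ∀ i j, ellTheta (x i * z j) p ≠ 0)
    {t : ℂ} (ht0 : t ≠ 0)
    (ht : ∀ s : Finset (Fin n), ellTheta (t * ∏ i ∈ s, (x i * z i)) p ≠ 0) :
    ellTheta t p *
      (Matrix.of fun i j => ellTheta (t * (x i * z j)) p / ellTheta (x i * z j) p).det =
    ellTheta t p ^ n * ellTheta (t * ∏ i, (x i * z i)) p *
      ((∏ i, ∏ j, if i < j then
        x j * z j * (ellTheta (x i / x j) p * ellTheta (z i / z j) p) else 1) /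
      ∏ i, ∏ j, ellTheta (x i * z j) p) := by
  induction n generalizing t with
  | zero => simp
  | succ n ih =>
    have hx' := fun i : Fin n => hx i.succ
    have hz' := fun i : Fin n => hz i.succ
    have ht' : ellTheta (t * (x 0 * z 0)) p ≠ 0 := by simpa using ht {0}
    have htt : ellTheta t p ≠ 0 := by simpa using ht ∅
    have hIH := ih (fun i => x i.succ) (fun i => z i.succ) hx' hz' (fun i j => hxz _ _)
      (t := t * (x 0 * z 0)) (mul_ne_zero ht0 (mul_ne_zero (hx 0) (hz 0))) (fun s => by
        have := ht (Finset.cons 0 (s.map (Fin.succEmb n)) (by simp))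
        rw [Finset.prod_cons, Finset.prod_map] at this
        simpa [mul_assoc] using this)
    rw [Matrix.det_succ_eq_mul_det_schur _ (div_ne_zero ht' (hxz 0 0))]
    set c : Fin n → ℂ := fun i => ellTheta t p / ellTheta (t * (x 0 * z 0)) p *
      (x i.succ * ellTheta (x 0 / x i.succ) p / ellTheta (x i.succ * z 0) p) with hc
    set d : Fin n → ℂ := fun j => z j.succ * ellTheta (z 0 / z j.succ) p /
      ellTheta (x 0 * z j.succ) p with hd
    have hschur : (Matrix.of fun i j : Fin n =>
        (Matrix.of fun i j => ellTheta (t * (x i * z j)) p / ellTheta (x i * z j) p)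
          i.succ j.succ -
        (Matrix.of fun i j => ellTheta (t * (x i * z j)) p / ellTheta (x i * z j) p) i.succ 0 *
        (Matrix.of fun i j => ellTheta (t * (x i * z j)) p / ellTheta (x i * z j) p) 0 j.succ /
        (Matrix.of fun i j => ellTheta (t * (x i * z j)) p / ellTheta (x i * z j) p) 0 0) =
        Matrix.of fun i j : Fin n => c i * (Matrix.of fun i j => d j * (Matrix.of fun i j : Fin n =>
          ellTheta (t * (x 0 * z 0) * (x i.succ * z j.succ)) p /
            ellTheta (x i.succ * z j.succ) p) i j) i j := by
      ext i j
      simp only [Matrix.of_apply, hc, hd]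
      have := ellTheta_two_by_two hp hp0 ht0 (hx 0) (hx i.succ) (hz 0) (hz j.succ)
      have h1 := hxz 0 0
      have h2 := hxz i.succ 0
      have h3 := hxz 0 j.succ
      have h4 := hxz i.succ j.succ
      generalize ellTheta (t * (x 0 * z 0)) p = a₀₀ at *
      generalize ellTheta (t * (x 0 * z j.succ)) p = a₀₁ at *
      generalize ellTheta (t * (x i.succ * z 0)) p = a₁₀ at *
      generalize ellTheta (t * (x i.succ * z j.succ)) p = a₁₁ at *
      generalize ellTheta (t * (x 0 * z 0) * (x i.succ * z j.succ)) p = b at *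
      generalize ellTheta (x 0 * z 0) p = c₀₀ at *
      generalize ellTheta (x 0 * z j.succ) p = c₀₁ at *
      generalize ellTheta (x i.succ * z 0) p = c₁₀ at *
      generalize ellTheta (x i.succ * z j.succ) p = c₁₁ at *
      generalize ellTheta (x 0 / x i.succ) p = e at *
      generalize ellTheta (z 0 / z j.succ) p = g at *
      field_simp
      linear_combination this
    rw [hschur, Matrix.det_mul_column, Matrix.det_mul_row]
    apply mul_left_cancel₀ ht'
    simp only [Matrix.of_apply]
    calc _ = ellTheta t p * (ellTheta (t * (x 0 * z 0)) p / ellTheta (x 0 * z 0) p) *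
          ((∏ i, c i) * ∏ j, d j) * (ellTheta (t * (x 0 * z 0)) p * (Matrix.of fun i j : Fin n =>
          ellTheta (t * (x 0 * z 0) * (x i.succ * z j.succ)) p /
            ellTheta (x i.succ * z j.succ) p).det) := by ring
      _ = _ := by
        rw [hIH]
        simp only [Fin.prod_univ_succ, Fin.succ_lt_succ_iff, Fin.not_lt_zero, Fin.succ_pos,
          if_true, if_false, one_mul, hc, hd, Finset.prod_mul_distrib,
          Finset.prod_div_distrib, Finset.prod_const, Finset.card_univ, Fintype.card_fin]
        rw [mul_mul_mul_comm (x 0), ← mul_assoc t (x 0 * z 0)]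
        have h1 := hxz 0 0
        have h2 : ∏ i : Fin n, ellTheta (x i.succ * z 0) p ≠ 0 :=
          Finset.prod_ne_zero_iff.mpr fun i _ => hxz _ _
        have h3 : ∏ i : Fin n, ellTheta (x 0 * z i.succ) p ≠ 0 :=
          Finset.prod_ne_zero_iff.mpr fun i _ => hxz _ _
        have h4 : ∏ i : Fin n, ∏ j : Fin n, ellTheta (x i.succ * z j.succ) p ≠ 0 :=
          Finset.prod_ne_zero_iff.mpr fun i _ => Finset.prod_ne_zero_iff.mpr fun j _ => hxz _ _
        generalize ellTheta (t * (x 0 * z 0)) p = a at *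
        generalize ellTheta (x 0 * z 0) p = b at *
        generalize ellTheta (t * (x 0 * z 0) * _) p = e at *
        generalize ∏ i : Fin n, ellTheta (x i.succ * z 0) p = e₁ at *
        generalize ∏ i : Fin n, ellTheta (x 0 * z i.succ) p = e₂ at *
        generalize ∏ i : Fin n, ∏ j : Fin n, ellTheta (x i.succ * z j.succ) p = e₃ at *
        field_simp
        ring

lemma continuous_comp_torus {n : ℕ} {F : (Fin n → ℂ) → ℂ}
    (hF : ContinuousOn F {z | ∀ i, ‖z i‖ = 1}) :
    Continuous fun θ : Fin n → ℝ => F fun i => Complex.exp (Complex.I * θ i) :=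
  hF.comp_continuous (by fun_prop) fun θ i => by
    rw [mul_comm, Complex.norm_exp_ofReal_mul_I]

lemma torusInt_prod {n : ℕ} (g : Fin n → ℂ → ℂ) :
    torusInt n (fun z => ∏ j, g j (z j)) = ∏ j, Real.circleAverage (g j) 0 1 := by
  rw [torusInt, volume_pi, Measure.restrict_pi_pi,
    integral_fintype_prod_eq_prod
      (f := fun j (θ : ℝ) => g j (Complex.exp (Complex.I * θ)))]
  have : ∀ j, Real.circleAverage (g j) 0 1 = ((1 / (2 * Real.pi) : ℝ) : ℂ) *
      ∫ θ in Set.Icc (0 : ℝ) (2 * Real.pi), g j (Complex.exp (Complex.I * θ)) := by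
    intro j
    rw [Real.circleAverage_def, integral_Icc_eq_integral_Ioc,
      ← intervalIntegral.integral_of_le (by positivity), Complex.real_smul, one_div]
    simp [circleMap, mul_comm]
  simp [this, Finset.prod_mul_distrib]

lemma torusInt_const_mul {n : ℕ} (c : ℂ) (F : (Fin n → ℂ) → ℂ) :
    torusInt n (fun z => c * F z) = c * torusInt n F := by
  rw [torusInt, torusInt, integral_const_mul]
  ring

lemma torusInt_congr {n : ℕ} {F G : (Fin n → ℂ) → ℂ} (h : ∀ z, (∀ i, ‖z i‖ = 1) → F z = G z) :
    torusInt n F = torusInt n G := by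
  rw [torusInt, torusInt]
  congr 2
  ext θ
  exact h _ fun i => by rw [mul_comm, Complex.norm_exp_ofReal_mul_I]

lemma torusInt_finset_sum {n : ℕ} {ι : Type*} (s : Finset ι) (F : ι → (Fin n → ℂ) → ℂ)
    (hF : ∀ i ∈ s, ContinuousOn (F i) {z | ∀ i, ‖z i‖ = 1}) :
    torusInt n (fun z => ∑ i ∈ s, F i z) = ∑ i ∈ s, torusInt n (F i) := by
  simp only [torusInt]
  rw [integral_finsetSum, Finset.mul_sum]
  exact fun i hi => (continuous_comp_torus (hF i hi)).continuousOn.integrableOn_compact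
    (isCompact_univ_pi fun _ => isCompact_Icc)

/-- Andréief's identity on the unit torus, before resummation. -/
lemma torusInt_det_mul_det {n : ℕ} (A B : Fin n → ℂ → ℂ)
    (hA : ∀ i, ContinuousOn (A i) (Metric.sphere 0 1))
    (hB : ∀ i, ContinuousOn (B i) (Metric.sphere 0 1)) :
    torusInt n (fun z => (Matrix.of fun i j => A i (z j)).det *
      (Matrix.of fun i j => B i (z j)).det) =
    ∑ σ : Equiv.Perm (Fin n), ∑ τ : Equiv.Perm (Fin n),
      ((Equiv.Perm.sign σ : ℤ) : ℂ) * ((Equiv.Perm.sign τ : ℤ) : ℂ) *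
        ∏ j, Real.circleAverage (fun z => A (σ j) z * B (τ j) z) 0 1 := by
  have hc : ∀ (C : Fin n → ℂ → ℂ), (∀ i, ContinuousOn (C i) (Metric.sphere 0 1)) →
      ∀ i j, ContinuousOn (fun z : Fin n → ℂ => C i (z j)) {z | ∀ i, ‖z i‖ = 1} :=
    fun C hC i j => (hC i).comp (continuous_apply j).continuousOn fun z hz => by simpa using hz j
  simp only [Matrix.det_apply', Finset.sum_mul_sum, Matrix.of_apply]
  rw [torusInt_finset_sum]
  · refine Finset.sum_congr rfl fun σ _ => ?_
    rw [torusInt_finset_sum]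
    · refine Finset.sum_congr rfl fun τ _ => ?_
      rw [← torusInt_prod, ← torusInt_const_mul]
      congr 1
      ext z
      rw [Finset.prod_mul_distrib]
      ring
    · exact fun τ _ => (continuousOn_const.mul (continuousOn_finsetProd _ fun i _ =>
        hc A hA _ _)).mul (continuousOn_const.mul (continuousOn_finsetProd _ fun i _ =>
        hc B hB _ _))
  · exact fun σ _ => continuousOn_finsetSum _ fun τ _ => (continuousOn_const.mul
      (continuousOn_finsetProd _ fun i _ => hc A hA _ _)).mul (continuousOn_const.mul
      (continuousOn_finsetProd _ fun i _ => hc B hB _ _))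

lemma circleAverage_mul_div_symm {F G : ℂ → ℂ} {a : ℝ} (ha : 0 < a)
    (hF : ∀ w, a < ‖w‖ → ‖w‖ < 1 → DifferentiableAt ℂ F w)
    (hG : ∀ w, a < ‖w‖ → ‖w‖ < 1 → DifferentiableAt ℂ G w) {x y : ℂ}
    (hx : a < ‖x‖) (hx1 : ‖x‖ < 1) (hy : a < ‖y‖) (hy1 : ‖y‖ < 1) :
    Real.circleAverage (fun z => F (x * z) * G (y / z)) 0 1 =
      Real.circleAverage (fun z => F (y * z) * G (x / z)) 0 1 := by
  have hx0 : x ≠ 0 := norm_pos_iff.mp (ha.trans hx)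
  have hy0 : y ≠ 0 := norm_pos_iff.mp (ha.trans hy)
  let h : ℂ → ℂ := fun w => F w * G (x * y / w)
  have e1 : (fun z => F (x * z) * G (y / z)) = fun z => h (x * z) := by
    ext z
    simp only [h, mul_div_mul_left _ _ hx0]
  have e2 : (fun z => F (y * z) * G (x / z)) = fun z => h (y * z) := by
    ext z
    simp only [h]
    rw [mul_comm x y, mul_div_mul_left _ _ hy0]
  rw [e1, e2, circleAverage_comp_const_mul, circleAverage_comp_const_mul, mul_one, mul_one]
  refine circleAverage_eq_of_differentiableAt_annulus (ha.trans hx) (ha.trans hy) fun w h1 h2 => ?_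
  have hw0 : 0 < ‖w‖ := lt_of_lt_of_le (lt_min (ha.trans hx) (ha.trans hy)) h1
  have hw1 : ‖w‖ < 1 := lt_of_le_of_lt h2 (max_lt hx1 hy1)
  have hwa : a < ‖w‖ := lt_of_lt_of_le (lt_min hx hy) h1
  have hprod : ‖x‖ * ‖y‖ = min ‖x‖ ‖y‖ * max ‖x‖ ‖y‖ := (min_mul_max _ _).symm
  have hmin : a < min ‖x‖ ‖y‖ := lt_min hx hy
  have hmax : max ‖x‖ ‖y‖ < 1 := max_lt hx1 hy1
  have hb1 : a < ‖x * y / w‖ := by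
    rw [norm_div, norm_mul, hprod, lt_div_iff₀ hw0]
    exact lt_of_lt_of_le (mul_lt_mul_of_pos_right hmin hw0)
      (mul_le_mul_of_nonneg_left h2 (ha.trans hmin).le)
  have hb2 : ‖x * y / w‖ < 1 := by
    rw [norm_div, norm_mul, hprod, div_lt_one hw0]
    exact lt_of_lt_of_le (mul_lt_of_lt_one_right (ha.trans hmin) hmax) h1
  have hw : w ≠ 0 := norm_pos_iff.mp hw0
  exact (hF w hwa hw1).mul ((hG _ hb1 hb2).comp w
    ((differentiableAt_const _).div differentiableAt_id hw))

lemma torusInt_det_mul_det_symm {n : ℕ} {F G : ℂ → ℂ} {a : ℝ} (ha : 0 < a)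
    (hF : ∀ w, a < ‖w‖ → ‖w‖ < 1 → DifferentiableAt ℂ F w)
    (hG : ∀ w, a < ‖w‖ → ‖w‖ < 1 → DifferentiableAt ℂ G w) {x y : Fin n → ℂ}
    (hx : ∀ i, a < ‖x i‖ ∧ ‖x i‖ < 1) (hy : ∀ i, a < ‖y i‖ ∧ ‖y i‖ < 1) :
    torusInt n (fun z => (Matrix.of fun i j => F (x i * z j)).det *
      (Matrix.of fun i j => G (y i / z j)).det) =
    torusInt n (fun z => (Matrix.of fun i j => F (y i * z j)).det *
      (Matrix.of fun i j => G (x i / z j)).det) := by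
  have hcF : ∀ u : ℂ, a < ‖u‖ ∧ ‖u‖ < 1 →
      ContinuousOn (fun z => F (u * z)) (Metric.sphere 0 1) := fun u hu z hz => by
    have hz : ‖z‖ = 1 := by simpa using hz
    refine (ContinuousAt.comp (g := F) (hF _ ?_ ?_).continuousAt
      (continuous_const_mul u).continuousAt).continuousWithinAt <;> simp [hz, hu]
  have hcG : ∀ u : ℂ, a < ‖u‖ ∧ ‖u‖ < 1 →
      ContinuousOn (fun z => G (u / z)) (Metric.sphere 0 1) := fun u hu z hz => by
    have hz : ‖z‖ = 1 := by simpa using hz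
    have hz0 : z ≠ 0 := norm_pos_iff.mp (by simp [hz])
    refine (ContinuousAt.comp (g := G) (hG _ ?_ ?_).continuousAt
      (continuousAt_const.div continuousAt_id hz0)).continuousWithinAt <;> simp [hz, hu]
  rw [torusInt_det_mul_det (fun i z => F (x i * z)) (fun i z => G (y i / z))
      (fun i => hcF _ (hx i)) (fun i => hcG _ (hy i)),
    torusInt_det_mul_det (fun i z => F (y i * z)) (fun i z => G (x i / z))
      (fun i => hcF _ (hy i)) (fun i => hcG _ (hx i)), Finset.sum_comm]
  refine Finset.sum_congr rfl fun τ _ => Finset.sum_congr rfl fun σ _ => ?_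
  rw [mul_comm ((Equiv.Perm.sign σ : ℤ) : ℂ)]
  congr 1
  exact Finset.prod_congr rfl fun j _ => circleAverage_mul_div_symm ha hF hG
    (hx _).1 (hx _).2 (hy _).1 (hy _).2

/-- The integrand of the `A_n` integral, normalised so that it is a product of two Cauchy-type
determinants up to the test function. -/
noncomputable def ellKernel {n : ℕ} (p q : ℂ) (x y z : Fin n → ℂ) : ℂ :=
  (∏ i, ∏ j, if i < j then x j * y j * (ellTheta (x i / x j) p * ellTheta (y i / y j) q) else 1) *
    ((∏ i, ∏ j, if i < j then ellTheta (z i / z j) p * ellTheta (z j / z i) q else 1) /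
      ∏ i, ∏ j, ellTheta (x i * z j) p * ellTheta (y i / z j) q)

lemma ellKernel_mul_theta {n : ℕ} {p q : ℂ} (hp : ‖p‖ < 1) (hp0 : p ≠ 0) (hq : ‖q‖ < 1)
    (hq0 : q ≠ 0) {x y z : Fin n → ℂ} (hx : ∀ i, x i ≠ 0) (hy : ∀ i, y i ≠ 0) (hz : ∀ i, z i ≠ 0)
    (hxz : ∀ i j, ellTheta (x i * z j) p ≠ 0) (hyz : ∀ i j, ellTheta (y i / z j) q ≠ 0)
    {t s : ℂ} (ht0 : t ≠ 0) (hs0 : s ≠ 0)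
    (ht : ∀ u : Finset (Fin n), ellTheta (t * ∏ i ∈ u, (x i * z i)) p ≠ 0)
    (hs : ∀ u : Finset (Fin n), ellTheta (s * ∏ i ∈ u, (y i / z i)) q ≠ 0) (k : ℤ) :
    ((∏ i, x i) * ∏ i, z i) ^ k * ellTheta (t * ∏ i, (x i * z i)) p *
      ellTheta (s * ∏ i, (y i / z i)) q * ellKernel p q x y z =
    ellTheta t p * ellTheta s q / (ellTheta t p ^ n * ellTheta s q ^ n) *
      ((Matrix.of fun i j => (x i * z j) ^ k *
          (ellTheta (t * (x i * z j)) p / ellTheta (x i * z j) p)).det *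
        (Matrix.of fun i j => ellTheta (s * (y i / z j)) q / ellTheta (y i / z j) q).det) := by
  have htt : ellTheta t p ≠ 0 := by simpa using ht ∅
  have hss : ellTheta s q ≠ 0 := by simpa using hs ∅
  have hpow : (Matrix.of fun i j => (x i * z j) ^ k *
      (ellTheta (t * (x i * z j)) p / ellTheta (x i * z j) p)).det =
      ((∏ i, x i) * ∏ i, z i) ^ k *
        (Matrix.of fun i j => ellTheta (t * (x i * z j)) p / ellTheta (x i * z j) p).det := by
    have : (Matrix.of fun i j => (x i * z j) ^ k *
        (ellTheta (t * (x i * z j)) p / ellTheta (x i * z j) p)) =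
        Matrix.of fun i j => x i ^ k * (Matrix.of fun i j => z j ^ k * (Matrix.of fun i j =>
          ellTheta (t * (x i * z j)) p / ellTheta (x i * z j) p) i j) i j := by
      ext i j
      simp only [Matrix.of_apply, mul_zpow, mul_assoc]
    rw [this, Matrix.det_mul_column, Matrix.det_mul_row, mul_zpow, Finset.prod_zpow,
      Finset.prod_zpow, mul_assoc]
  have h1 := ellTheta_frobenius hp hp0 n x z hx hz hxz ht0 ht
  have h2 := ellTheta_frobenius hq hq0 n y (fun i => (z i)⁻¹) hy (fun i => inv_ne_zero (hz i))
    (by simpa only [div_eq_mul_inv] using hyz) hs0 (by simpa only [div_eq_mul_inv] using hs)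
  simp only [← div_eq_mul_inv] at h2
  have hker : ellKernel p q x y z =
      ((∏ i, ∏ j, if i < j then
        x j * z j * (ellTheta (x i / x j) p * ellTheta (z i / z j) p) else 1) /
      ∏ i, ∏ j, ellTheta (x i * z j) p) * ((∏ i, ∏ j, if i < j then
        y j / z j * (ellTheta (y i / y j) q * ellTheta ((z i)⁻¹ / (z j)⁻¹) q) else 1) /
      ∏ i, ∏ j, ellTheta (y i / z j) q) := by
    rw [ellKernel, div_mul_div_comm, mul_div_assoc']
    simp only [← Finset.prod_mul_distrib]
    congr 1
    refine Finset.prod_congr rfl fun i _ => Finset.prod_congr rfl fun j _ => ?_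
    split_ifs
    · rw [inv_div_inv]
      have := hz j
      have h : x j * z j * (ellTheta (x i / x j) p * ellTheta (z i / z j) p) *
          (y j / z j * (ellTheta (y i / y j) q * ellTheta (z j / z i) q)) =
          (z j / z j) * (x j * y j * (ellTheta (x i / x j) p * ellTheta (y i / y j) q) *
          (ellTheta (z i / z j) p * ellTheta (z j / z i) q)) := by ring
      rw [h, div_self this, one_mul]
    · simp
  rw [hpow, hker]
  generalize (Matrix.of fun i j => ellTheta (t * (x i * z j)) p / ellTheta (x i * z j) p).det = D₁
    at *
  generalize (Matrix.of fun i j => ellTheta (s * (y i / z j)) q / ellTheta (y i / z j) q).det = D₂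
    at *
  generalize ellTheta t p = a at *
  generalize ellTheta s q = b at *
  generalize ((∏ i, x i) * ∏ i, z i) ^ k = c at *
  generalize ellTheta (t * ∏ i, (x i * z i)) p = e at *
  generalize ellTheta (s * ∏ i, (y i / z i)) q = g at *
  have h3 : a * b / (a ^ n * b ^ n) * (c * D₁ * D₂) = c * (a * D₁) * (b * D₂) / (a ^ n * b ^ n) := by
    ring
  rw [h3, h1, h2]
  field_simp

lemma torusInt_ellKernel_symm {n : ℕ} {p q : ℂ} (hp : ‖p‖ < 1) (hp0 : p ≠ 0) (hq : ‖q‖ < 1)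
    (hq0 : q ≠ 0) {x y : Fin n → ℂ} (hx : ∀ i, max ‖p‖ ‖q‖ < ‖x i‖ ∧ ‖x i‖ < 1)
    (hy : ∀ i, max ‖p‖ ‖q‖ < ‖y i‖ ∧ ‖y i‖ < 1) {t s : ℂ} (ht0 : t ≠ 0) (hs0 : s ≠ 0)
    (htx : ∀ (u : Finset (Fin n)) (m : ℤ), ‖t‖ * ∏ i ∈ u, ‖x i‖ ≠ ‖p‖ ^ m)
    (hty : ∀ (u : Finset (Fin n)) (m : ℤ), ‖t‖ * ∏ i ∈ u, ‖y i‖ ≠ ‖p‖ ^ m)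
    (hsx : ∀ (u : Finset (Fin n)) (m : ℤ), ‖s‖ * ∏ i ∈ u, ‖x i‖ ≠ ‖q‖ ^ m)
    (hsy : ∀ (u : Finset (Fin n)) (m : ℤ), ‖s‖ * ∏ i ∈ u, ‖y i‖ ≠ ‖q‖ ^ m) (k : ℤ) :
    torusInt n (fun z => ((∏ i, x i) * ∏ i, z i) ^ k * ellTheta (t * ∏ i, (x i * z i)) p *
      ellTheta (s * ∏ i, (y i / z i)) q * ellKernel p q x y z) =
    torusInt n (fun z => ((∏ i, y i) * ∏ i, z i) ^ k * ellTheta (t * ∏ i, (y i * z i)) p *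
      ellTheta (s * ∏ i, (x i / z i)) q * ellKernel p q y x z) := by
  have ha : 0 < max ‖p‖ ‖q‖ := lt_max_of_lt_left (norm_pos_iff.mpr hp0)
  have key : ∀ x y : Fin n → ℂ, (∀ i, max ‖p‖ ‖q‖ < ‖x i‖ ∧ ‖x i‖ < 1) →
      (∀ i, max ‖p‖ ‖q‖ < ‖y i‖ ∧ ‖y i‖ < 1) →
      (∀ (u : Finset (Fin n)) (m : ℤ), ‖t‖ * ∏ i ∈ u, ‖x i‖ ≠ ‖p‖ ^ m) →
      (∀ (u : Finset (Fin n)) (m : ℤ), ‖s‖ * ∏ i ∈ u, ‖y i‖ ≠ ‖q‖ ^ m) →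
      torusInt n (fun z => ((∏ i, x i) * ∏ i, z i) ^ k * ellTheta (t * ∏ i, (x i * z i)) p *
        ellTheta (s * ∏ i, (y i / z i)) q * ellKernel p q x y z) =
      ellTheta t p * ellTheta s q / (ellTheta t p ^ n * ellTheta s q ^ n) *
      torusInt n (fun z => (Matrix.of fun i j => (x i * z j) ^ k *
          (ellTheta (t * (x i * z j)) p / ellTheta (x i * z j) p)).det *
        (Matrix.of fun i j => ellTheta (s * (y i / z j)) q / ellTheta (y i / z j) q).det) := by
    intro x y hx hy htx hsy
    rw [← torusInt_const_mul]
    refine torusInt_congr fun z hz => ?_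
    have hx0 : ∀ i, x i ≠ 0 := fun i => norm_pos_iff.mp (ha.trans (hx i).1)
    have hy0 : ∀ i, y i ≠ 0 := fun i => norm_pos_iff.mp (ha.trans (hy i).1)
    have hz0 : ∀ i, z i ≠ 0 := fun i => norm_pos_iff.mp (by simp [hz i])
    refine ellKernel_mul_theta hp hp0 hq hq0 hx0 hy0 hz0 (fun i j => ?_) (fun i j => ?_) ht0 hs0
      (fun u => ?_) (fun u => ?_) k
    · refine ellTheta_ne_zero_of_norm_lt hp hp0 ?_ ?_ <;> rw [norm_mul, hz, mul_one]
      exacts [(le_max_left _ _).trans_lt (hx i).1, (hx i).2]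
    · refine ellTheta_ne_zero_of_norm_lt hq hq0 ?_ ?_ <;> rw [norm_div, hz, div_one]
      exacts [(le_max_right _ _).trans_lt (hy i).1, (hy i).2]
    · refine ellTheta_ne_zero hp hp0 (mul_ne_zero ht0
        (Finset.prod_ne_zero_iff.mpr fun i _ => mul_ne_zero (hx0 i) (hz0 i))) fun m => ?_
      simpa [hz] using htx u m
    · refine ellTheta_ne_zero hq hq0 (mul_ne_zero hs0
        (Finset.prod_ne_zero_iff.mpr fun i _ => div_ne_zero (hy0 i) (hz0 i))) fun m => ?_
      simpa [hz] using hsy u m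
  rw [key x y hx hy htx hsy, key y x hy hx hty hsx]
  congr 1
  refine torusInt_det_mul_det_symm (F := fun w => w ^ k * (ellTheta (t * w) p / ellTheta w p))
    (G := fun w => ellTheta (s * w) q / ellTheta w q) ha (fun w h1 h2 => ?_) (fun w h1 h2 => ?_)
    hx hy
  all_goals have hw : w ≠ 0 := norm_pos_iff.mp (ha.trans h1)
  · refine (differentiableAt_zpow.mpr (Or.inl hw)).mul (DifferentiableAt.div ?_
      (differentiableAt_ellTheta hp hw)
      (ellTheta_ne_zero_of_norm_lt hp hp0 ((le_max_left _ _).trans_lt h1) h2))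
    exact (differentiableAt_ellTheta hp (mul_ne_zero ht0 hw)).comp w
      (differentiableAt_id.const_mul t)
  · refine DifferentiableAt.div ?_ (differentiableAt_ellTheta hq hw)
      (ellTheta_ne_zero_of_norm_lt hq hq0 ((le_max_right _ _).trans_lt h1) h2)
    exact (differentiableAt_ellTheta hq (mul_ne_zero hs0 hw)).comp w
      (differentiableAt_id.const_mul s)

lemma exists_pos_mul_ne {S C : Set ℝ} (hS : S.Countable) (hC : C.Countable) :
    ∃ ρ : ℝ, 0 < ρ ∧ ∀ c ∈ C, c ≠ 0 → ∀ b ∈ S, ρ * c ≠ b := by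
  obtain ⟨ρ, hρ, hpos⟩ := ((hS.image2 hC (· / ·)).dense_compl ℝ).exists_gt 0
  refine ⟨ρ, hpos, fun c hc hc0 b hb h => hρ ⟨b, hb, c, hc, ?_⟩⟩
  rw [div_eq_iff hc0, h]

lemma torusInt_circleAverage {n : ℕ} {Ψ : ℂ → (Fin n → ℂ) → ℂ} {ρ : ℝ} (hρ : 0 ≤ ρ)
    (hΨ : ContinuousOn (Function.uncurry Ψ)
      (Metric.sphere 0 ρ ×ˢ {z : Fin n → ℂ | ∀ i, ‖z i‖ = 1})) :
    torusInt n (fun z => Real.circleAverage (fun t => Ψ t z) 0 ρ) =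
      Real.circleAverage (fun t => torusInt n (Ψ t)) 0 ρ := by
  simp only [Real.circleAverage_def, torusInt, Complex.real_smul,
    intervalIntegral.integral_of_le Real.two_pi_pos.le]
  rw [integral_const_mul, integral_const_mul, integral_integral_swap]
  · ring
  · have hc : Continuous (Function.uncurry fun (θ : Fin n → ℝ) (τ : ℝ) =>
        Ψ (circleMap 0 ρ τ) fun i => Complex.exp (Complex.I * θ i)) := by
      refine hΨ.comp_continuous (f := fun w : (Fin n → ℝ) × ℝ =>
        (circleMap 0 ρ w.2, fun i => Complex.exp (Complex.I * w.1 i))) ?_ fun w => ⟨?_, fun i => ?_⟩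
      · exact ((continuous_circleMap 0 ρ).comp continuous_snd).prodMk (by fun_prop)
      · exact circleMap_mem_sphere 0 hρ _
      · change ‖Complex.exp (Complex.I * w.1 i)‖ = 1
        rw [mul_comm, Complex.norm_exp_ofReal_mul_I]
    rw [Measure.prod_restrict]
    exact (hc.continuousOn.integrableOn_compact ((isCompact_univ_pi fun _ => isCompact_Icc).prod
      isCompact_Icc)).mono_set (Set.prod_mono le_rfl Set.Ioc_subset_Icc_self)

lemma ContinuousOn.ellTheta {E : Type*} [TopologicalSpace E] {p : ℂ} (hp : ‖p‖ < 1) {g : E → ℂ}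
    {s : Set E} (hg : ContinuousOn g s) (h0 : ∀ z ∈ s, g z ≠ 0) :
    ContinuousOn (fun z => ellTheta (g z) p) s := fun z hz =>
  ContinuousAt.comp_continuousWithinAt (g := fun x => _root_.ellTheta x p)
    (continuousAt_ellTheta hp (h0 z hz)) (hg z hz)

lemma circleAverage_ellTheta {p : ℂ} (hp : ‖p‖ < 1) {ρ : ℝ} (hρ : 0 < ρ) {v : ℂ} (hv : v ≠ 0) :
    Real.circleAverage (fun t => ellTheta (t * v) p) 0 ρ =
      laurentCoeff (fun x => ellTheta x p) 0 := by
  simp only [mul_comm _ v, laurentCoeff, neg_zero, zpow_zero, mul_one]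
  rw [circleAverage_comp_const_mul (fun x => ellTheta x p)]
  refine circleAverage_eq_of_differentiableAt_annulus (mul_pos (norm_pos_iff.mpr hv) hρ) one_pos
    fun z h _ => differentiableAt_ellTheta hp (norm_pos_iff.mp (lt_of_lt_of_le
      (lt_min (mul_pos (norm_pos_iff.mpr hv) hρ) one_pos) h))

lemma torusInt_eq_of_forall_ellTheta_mul {n : ℕ} {p : ℂ} (hp : ‖p‖ < 1) (hp0 : p ≠ 0)
    {V₁ V₂ g₁ g₂ : (Fin n → ℂ) → ℂ}
    (hV₁ : ContinuousOn V₁ {z | ∀ i, ‖z i‖ = 1}) (hV₂ : ContinuousOn V₂ {z | ∀ i, ‖z i‖ = 1})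
    (hg₁ : ContinuousOn g₁ {z | ∀ i, ‖z i‖ = 1}) (hg₂ : ContinuousOn g₂ {z | ∀ i, ‖z i‖ = 1})
    (h₁ : ∀ z, (∀ i, ‖z i‖ = 1) → g₁ z ≠ 0) (h₂ : ∀ z, (∀ i, ‖z i‖ = 1) → g₂ z ≠ 0)
    {ρ : ℝ} (hρ : 0 < ρ)
    (h : ∀ t : ℂ, ‖t‖ = ρ → torusInt n (fun z => ellTheta (t * g₁ z) p * V₁ z) =
      torusInt n (fun z => ellTheta (t * g₂ z) p * V₂ z)) :
    torusInt n V₁ = torusInt n V₂ := by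
  have key : ∀ V g : (Fin n → ℂ) → ℂ, ContinuousOn V {z | ∀ i, ‖z i‖ = 1} →
      ContinuousOn g {z | ∀ i, ‖z i‖ = 1} → (∀ z, (∀ i, ‖z i‖ = 1) → g z ≠ 0) →
      laurentCoeff (fun x => ellTheta x p) 0 * torusInt n V =
      Real.circleAverage (fun t => torusInt n (fun z => ellTheta (t * g z) p * V z)) 0 ρ := by
    intro V g hV hg h0
    rw [← torusInt_circleAverage hρ.le, ← torusInt_const_mul]
    · refine torusInt_congr fun z hz => ?_
      rw [← circleAverage_ellTheta hp hρ (h0 z hz)]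
      simp only [mul_comm _ (V z), ← smul_eq_mul (V z)]
      rw [Real.circleAverage_fun_smul]
    · have hsnd : ∀ {W : (Fin n → ℂ) → ℂ}, ContinuousOn W {z | ∀ i, ‖z i‖ = 1} →
          ContinuousOn (fun w : ℂ × (Fin n → ℂ) => W w.2)
            (Metric.sphere 0 ρ ×ˢ {z : Fin n → ℂ | ∀ i, ‖z i‖ = 1}) :=
        fun hW => hW.comp continuous_snd.continuousOn fun w hw => hw.2
      refine ContinuousOn.mul (ContinuousOn.ellTheta hp (continuous_fst.continuousOn.mul (hsnd hg))
        fun w hw => mul_ne_zero (norm_pos_iff.mp ?_) (h0 _ hw.2)) (hsnd hV)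
      rwa [mem_sphere_zero_iff_norm.mp hw.1]
  refine mul_left_cancel₀ (laurentCoeff_ellTheta_zero_ne_zero hp hp0) ?_
  rw [key V₁ g₁ hV₁ hg₁ h₁, key V₂ g₂ hV₂ hg₂ h₂]
  refine Real.circleAverage_congr_sphere fun t ht => h t ?_
  simpa [abs_of_pos hρ] using ht

lemma hasSum_torusInt_zpow {n : ℕ} {f : ℂ → ℂ} (hf : ∀ z, z ≠ 0 → DifferentiableAt ℂ f z) {a : ℂ}
    (ha : a ≠ 0) {V : (Fin n → ℂ) → ℂ} (hV : ContinuousOn V {z | ∀ i, ‖z i‖ = 1}) :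
    HasSum (fun k : ℤ => laurentCoeff f k * torusInt n (fun z => (a * ∏ i, z i) ^ k * V z))
      (torusInt n (fun z => f (a * ∏ i, z i) * V z)) := by
  have hpow : ∀ k : ℤ, ContinuousOn
      (fun z : Fin n → ℂ => laurentCoeff f k * ((a * ∏ i, z i) ^ k * V z))
      {z | ∀ i, ‖z i‖ = 1} := fun k => continuousOn_const.mul <| ContinuousOn.mul
    (ContinuousOn.zpow₀ (by fun_prop) k fun z hz => Or.inl (mul_ne_zero ha
      (Finset.prod_ne_zero_iff.mpr fun i _ => norm_pos_iff.mp (by simp [hz i])))) hV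
  have hbox := isCompact_univ_pi fun _ : Fin n => isCompact_Icc (a := (0 : ℝ)) (b := 2 * Real.pi)
  have hs := hasSum_integral_of_summable_integral_norm
    (μ := volume.restrict (Set.univ.pi fun _ : Fin n => Set.Icc (0 : ℝ) (2 * Real.pi)))
    (F := fun (k : ℤ) θ => laurentCoeff f k * ((a * ∏ i, Complex.exp (Complex.I * (θ i : ℝ))) ^ k *
      V fun i => Complex.exp (Complex.I * (θ i : ℝ))))
    (fun k => (continuous_comp_torus (hpow k)).continuousOn.integrableOn_compact hbox) (by
      simp only [norm_mul, norm_zpow, norm_prod, mul_comm Complex.I,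
        Complex.norm_exp_ofReal_mul_I, Finset.prod_const_one, mul_one, ← mul_assoc]
      simp only [integral_const_mul]
      exact (summable_norm_laurentCoeff_mul hf (norm_pos_iff.mpr ha)).mul_right _)
  have htsum : ∀ θ : Fin n → ℝ, f (a * ∏ i, Complex.exp (Complex.I * (θ i : ℝ))) *
      V (fun i => Complex.exp (Complex.I * (θ i : ℝ))) = ∑' k : ℤ, laurentCoeff f k *
        ((a * ∏ i, Complex.exp (Complex.I * (θ i : ℝ))) ^ k *
          V fun i => Complex.exp (Complex.I * (θ i : ℝ))) := fun θ => by
    have h := (hasSum_laurentCoeff hf (mul_ne_zero ha (Finset.prod_ne_zero_iff.mpr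
      fun i (_ : i ∈ Finset.univ) => Complex.exp_ne_zero (Complex.I * (θ i : ℝ))))).mul_right
      (V fun i => Complex.exp (Complex.I * (θ i : ℝ)))
    simp only [mul_assoc] at h
    exact h.tsum_eq.symm
  have hmul := fun k : ℤ => (torusInt_const_mul (laurentCoeff f k)
    fun z : Fin n → ℂ => (a * ∏ i, z i) ^ k * V z).symm
  simp only [hmul]
  simp only [torusInt, htsum]
  exact hs.mul_left _

lemma continuousOn_ellKernel {n : ℕ} {p q : ℂ} (hp : ‖p‖ < 1) (hp0 : p ≠ 0) (hq : ‖q‖ < 1)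
    (hq0 : q ≠ 0) {x y : Fin n → ℂ} (hx : ∀ i, ‖p‖ < ‖x i‖ ∧ ‖x i‖ < 1)
    (hy : ∀ i, ‖q‖ < ‖y i‖ ∧ ‖y i‖ < 1) :
    ContinuousOn (ellKernel p q x y) {z | ∀ i, ‖z i‖ = 1} := by
  have hz0 : ∀ z ∈ {z : Fin n → ℂ | ∀ i, ‖z i‖ = 1}, ∀ i, z i ≠ 0 :=
    fun z hz i => norm_pos_iff.mp (by simp [hz i])
  have hz : ∀ i, ContinuousOn (fun z : Fin n → ℂ => z i) {z | ∀ i, ‖z i‖ = 1} :=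
    fun i => (continuous_apply i).continuousOn
  have hdiv : ∀ (r : ℂ) (_ : ‖r‖ < 1) (i j : Fin n), ContinuousOn
      (fun z : Fin n → ℂ => ellTheta (z i / z j) r) {z | ∀ i, ‖z i‖ = 1} :=
    fun r hr i j => ((hz i).div (hz j) fun z h => hz0 z h j).ellTheta hr
      fun z h => div_ne_zero (hz0 z h i) (hz0 z h j)
  refine continuousOn_const.mul (ContinuousOn.div ?_ ?_ fun z hz => ?_)
  · refine continuousOn_finsetProd _ fun i _ => continuousOn_finsetProd _ fun j _ => ?_
    split_ifs
    · exact (hdiv p hp i j).mul (hdiv q hq j i)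
    · exact continuousOn_const
  · refine continuousOn_finsetProd _ fun i _ => continuousOn_finsetProd _ fun j _ =>
      ContinuousOn.mul ?_ ?_
    · exact (continuousOn_const.mul (hz j)).ellTheta hp fun z h =>
        mul_ne_zero (norm_pos_iff.mp ((norm_nonneg _).trans_lt (hx i).1)) (hz0 z h j)
    · exact (continuousOn_const.div (hz j) fun z h => hz0 z h j).ellTheta hq fun z h =>
        div_ne_zero (norm_pos_iff.mp ((norm_nonneg _).trans_lt (hy i).1)) (hz0 z h j)
  · refine Finset.prod_ne_zero_iff.mpr fun i _ => Finset.prod_ne_zero_iff.mpr fun j _ =>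
      mul_ne_zero (ellTheta_ne_zero_of_norm_lt hp hp0 ?_ ?_)
        (ellTheta_ne_zero_of_norm_lt hq hq0 ?_ ?_)
    all_goals simp [hz j, hx i, hy i]

lemma torusInt_zpow_mul_ellKernel_symm {n : ℕ} {p q : ℂ} (hp : ‖p‖ < 1) (hp0 : p ≠ 0)
    (hq : ‖q‖ < 1) (hq0 : q ≠ 0) {x y : Fin n → ℂ}
    (hx : ∀ i, max ‖p‖ ‖q‖ < ‖x i‖ ∧ ‖x i‖ < 1)
    (hy : ∀ i, max ‖p‖ ‖q‖ < ‖y i‖ ∧ ‖y i‖ < 1) (k : ℤ) :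
    torusInt n (fun z => ((∏ i, x i) * ∏ i, z i) ^ k * ellKernel p q x y z) =
      torusInt n (fun z => ((∏ i, y i) * ∏ i, z i) ^ k * ellKernel p q y x z) := by
  have hnx : ∀ i, 0 < ‖x i‖ := fun i => (norm_nonneg p).trans_lt ((le_max_left _ _).trans_lt (hx i).1)
  have hny : ∀ i, 0 < ‖y i‖ := fun i => (norm_nonneg p).trans_lt ((le_max_left _ _).trans_lt (hy i).1)
  obtain ⟨ρ, hρ, hne⟩ := exists_pos_mul_ne
    (S := (Set.range fun m : ℤ => ‖p‖ ^ m) ∪ Set.range fun m : ℤ => ‖q‖ ^ m)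
    (C := (Set.range fun u : Finset (Fin n) => ∏ i ∈ u, ‖x i‖) ∪
      Set.range fun u : Finset (Fin n) => ∏ i ∈ u, ‖y i‖)
    ((Set.countable_range _).union (Set.countable_range _))
    ((Set.countable_range _).union (Set.countable_range _))
  have hne_x := fun u : Finset (Fin n) => hne _ (Or.inl ⟨u, rfl⟩)
    (Finset.prod_pos fun i _ => hnx i).ne'
  have hne_y := fun u : Finset (Fin n) => hne _ (Or.inr ⟨u, rfl⟩)
    (Finset.prod_pos fun i _ => hny i).ne'
  have hz0 : ∀ z ∈ {z : Fin n → ℂ | ∀ i, ‖z i‖ = 1}, ∀ i, z i ≠ 0 :=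
    fun z hz i => norm_pos_iff.mp (by simp [hz i])
  have hK : ∀ x y : Fin n → ℂ, (∀ i, max ‖p‖ ‖q‖ < ‖x i‖ ∧ ‖x i‖ < 1) →
      (∀ i, max ‖p‖ ‖q‖ < ‖y i‖ ∧ ‖y i‖ < 1) → (∀ i, 0 < ‖x i‖) → ContinuousOn
      (fun z : Fin n → ℂ => ((∏ i, x i) * ∏ i, z i) ^ k * ellKernel p q x y z) {z | ∀ i, ‖z i‖ = 1} :=
    fun x y hx hy hnx => ContinuousOn.mul (ContinuousOn.zpow₀ (by fun_prop) k fun z hz =>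
        Or.inl (mul_ne_zero (Finset.prod_ne_zero_iff.mpr fun i _ => norm_pos_iff.mp (hnx i))
          (Finset.prod_ne_zero_iff.mpr fun i _ => hz0 z hz i)))
      (continuousOn_ellKernel hp hp0 hq hq0
        (fun i => ⟨(le_max_left _ _).trans_lt (hx i).1, (hx i).2⟩)
        (fun i => ⟨(le_max_right _ _).trans_lt (hy i).1, (hy i).2⟩))
  have hm : ∀ x : Fin n → ℂ, ContinuousOn (fun z : Fin n → ℂ => ∏ i, (x i * z i)) {z | ∀ i, ‖z i‖ = 1} :=
    fun x => by fun_prop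
  have hd : ∀ x : Fin n → ℂ, ContinuousOn (fun z : Fin n → ℂ => ∏ i, (x i / z i)) {z | ∀ i, ‖z i‖ = 1} :=
    fun x => continuousOn_finsetProd _ fun i _ => continuousOn_const.div
      (continuous_apply i).continuousOn fun z hz => hz0 z hz i
  have hm0 : ∀ x : Fin n → ℂ, (∀ i, 0 < ‖x i‖) → ∀ z : Fin n → ℂ, (∀ i, ‖z i‖ = 1) →
      ∏ i, (x i * z i) ≠ 0 := fun x hx z hz => Finset.prod_ne_zero_iff.mpr fun i _ =>
    mul_ne_zero (norm_pos_iff.mp (hx i)) (hz0 z hz i)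
  have hd0 : ∀ x : Fin n → ℂ, (∀ i, 0 < ‖x i‖) → ∀ z : Fin n → ℂ, (∀ i, ‖z i‖ = 1) →
      ∏ i, (x i / z i) ≠ 0 := fun x hx z hz => Finset.prod_ne_zero_iff.mpr fun i _ =>
    div_ne_zero (norm_pos_iff.mp (hx i)) (hz0 z hz i)
  have hθ : ∀ x : Fin n → ℂ, (∀ i, 0 < ‖x i‖) → ∀ t : ℂ, t ≠ 0 → ContinuousOn
      (fun z : Fin n → ℂ => ellTheta (t * ∏ i, (x i * z i)) p) {z | ∀ i, ‖z i‖ = 1} :=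
    fun x hx t ht => (continuousOn_const.mul (hm x)).ellTheta hp
      fun z hz => mul_ne_zero ht (hm0 x hx z hz)
  refine torusInt_eq_of_forall_ellTheta_mul hp hp0 (hK x y hx hy hnx) (hK y x hy hx hny)
    (hm x) (hm y) (hm0 x hnx) (hm0 y hny) hρ fun t ht => ?_
  have ht0 : t ≠ 0 := norm_pos_iff.mp (ht ▸ hρ)
  refine torusInt_eq_of_forall_ellTheta_mul hq hq0 ((hθ x hnx t ht0).mul (hK x y hx hy hnx))
    ((hθ y hny t ht0).mul (hK y x hy hx hny)) (hd y) (hd x) (hd0 y hny) (hd0 x hnx) hρ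
    fun s hs => ?_
  have hs0 : s ≠ 0 := norm_pos_iff.mp (hs ▸ hρ)
  convert torusInt_ellKernel_symm hp hp0 hq hq0 hx hy ht0 hs0
    (fun u m => ht ▸ hne_x u _ (Or.inl ⟨m, rfl⟩)) (fun u m => ht ▸ hne_y u _ (Or.inl ⟨m, rfl⟩))
    (fun u m => hs ▸ hne_x u _ (Or.inr ⟨m, rfl⟩)) (fun u m => hs ▸ hne_y u _ (Or.inr ⟨m, rfl⟩))
    k using 3 <;> ring

/-- The determinantal `A_n` integral transformation, for any test function `f`
holomorphic on `ℂ∖{0}`. -/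
theorem An_determinantal_case (n : ℕ) (hn : 1 ≤ n) (p q : ℂ)
    (hp0 : 0 < ‖p‖) (hp1 : ‖p‖ < 1)
    (hq0 : 0 < ‖q‖) (hq1 : ‖q‖ < 1)
    (x y : Fin n → ℂ)
    (hx : ∀ i, max ‖p‖ ‖q‖ < ‖x i‖ ∧
      ‖x i‖ < 1)
    (hy : ∀ i, max ‖p‖ ‖q‖ < ‖y i‖ ∧
      ‖y i‖ < 1)
    (hxne : ∀ i j, i ≠ j → ellTheta (x i / x j) p ≠ 0)
    (hyne : ∀ i j, i ≠ j → ellTheta (y i / y j) q ≠ 0)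
    (f : ℂ → ℂ) (hf : DifferentiableOn ℂ f {(0 : ℂ)}ᶜ) :
    torusInt n (fun z =>
      f ((∏ i, x i) * ∏ i, z i) *
        ((∏ i, ∏ j, if i < j then ellTheta (z i / z j) p * ellTheta (z j / z i) q else 1) /
          ∏ i, ∏ j, ellTheta (x i * z j) p * ellTheta (y i / z j) q)) =
    (∏ i, ∏ j, if i < j then
        ellTheta (x i / x j) q * ellTheta (y i / y j) p /
          (ellTheta (x i / x j) p * ellTheta (y i / y j) q)
      else 1) *
      torusInt n (fun z =>
        f ((∏ i, y i) * ∏ i, z i) *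
          ((∏ i, ∏ j, if i < j then ellTheta (z i / z j) p * ellTheta (z j / z i) q else 1) /
            ∏ i, ∏ j, ellTheta (y i * z j) p * ellTheta (x i / z j) q)) := by
  have hp : p ≠ 0 := norm_pos_iff.mp hp0
  have hq : q ≠ 0 := norm_pos_iff.mp hq0
  have hx0 : ∀ i, x i ≠ 0 := fun i =>
    norm_pos_iff.mp (hp0.trans ((le_max_left _ _).trans_lt (hx i).1))
  have hy0 : ∀ i, y i ≠ 0 := fun i =>
    norm_pos_iff.mp (hp0.trans ((le_max_left _ _).trans_lt (hy i).1))
  have hfd : ∀ z, z ≠ 0 → DifferentiableAt ℂ f z := fun z hz =>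
    hf.differentiableAt (isOpen_compl_singleton.mem_nhds hz)
  have hX := hasSum_torusInt_zpow hfd (a := ∏ i, x i) (Finset.prod_ne_zero_iff.mpr fun i _ => hx0 i)
    (continuousOn_ellKernel hp1 hp hq1 hq
      (fun i => ⟨(le_max_left _ _).trans_lt (hx i).1, (hx i).2⟩)
      (fun i => ⟨(le_max_right _ _).trans_lt (hy i).1, (hy i).2⟩))
  have hY := hasSum_torusInt_zpow hfd (a := ∏ i, y i) (Finset.prod_ne_zero_iff.mpr fun i _ => hy0 i)
    (continuousOn_ellKernel hp1 hp hq1 hq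
      (fun i => ⟨(le_max_left _ _).trans_lt (hy i).1, (hy i).2⟩)
      (fun i => ⟨(le_max_right _ _).trans_lt (hx i).1, (hx i).2⟩))
  simp only [torusInt_zpow_mul_ellKernel_symm hp1 hp hq1 hq hx hy] at hX
  have h := hX.unique hY
  simp only [ellKernel, mul_left_comm (f _)] at h
  rw [torusInt_const_mul, torusInt_const_mul] at h
  have hE : (∏ i, ∏ j, if i < j then
      x j * y j * (ellTheta (x i / x j) p * ellTheta (y i / y j) q) else 1) ≠ 0 := by
    refine Finset.prod_ne_zero_iff.mpr fun i _ => Finset.prod_ne_zero_iff.mpr fun j _ => ?_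
    split_ifs with hij
    · exact mul_ne_zero (mul_ne_zero (hx0 j) (hy0 j))
        (mul_ne_zero (hxne i j hij.ne) (hyne i j hij.ne))
    · exact one_ne_zero
  refine mul_left_cancel₀ hE ?_
  rw [h, ← mul_assoc]
  congr 1
  simp only [← Finset.prod_mul_distrib]
  refine Finset.prod_congr rfl fun i _ => Finset.prod_congr rfl fun j _ => ?_
  split_ifs with hij
  · rw [mul_assoc (x j * y j), mul_div_cancel₀ _ (mul_ne_zero (hxne i j hij.ne) (hyne i j hij.ne))]
    ring
  · simp
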